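/- arXiv:1304.5438 — 2 statements merged into one kernel-verified Lean document; each statement's English description precedes it below -/
import Mathlib

section
/- Let 0 < α < 1, G a finite directed graph in which every vertex has at least one outgoing edge, v₀ a vertex, P a reasonable probability measure, and W a countable intersection of open subsets of Paths(G,v₀). Then the generalized Banach–Mazur game G_α = (G,v₀,φ_α,φ_ball,W) is determined: Player 0 has a winning strategy for G_α (i.e., a winning α-strategy) if and only if P(W) = 1, and Player 1 has a winning strategy for G_α if and only if P(W) < 1. -/
open MeasureTheory
open scoped ENNReal NNReal

namespace BMGame

variable {V : Type*}

/-- The prefix of length `n` of the infinite sequence `ρ`. -/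
def pref (ρ : ℕ → V) (n : ℕ) : List V := (List.range n).map ρ

/-- `ρ` is an infinite path of the graph `E` starting at `v₀`. -/
def IsPlay (E : V → V → Prop) (v₀ : V) (ρ : ℕ → V) : Prop :=
  ρ 0 = v₀ ∧ ∀ n, E (ρ n) (ρ (n + 1))

/-- `π` is a nonempty finite path of the graph `E` starting at `v₀` (a position of the game). -/
def IsPos (E : V → V → Prop) (v₀ : V) (π : List V) : Prop :=
  π.head? = some v₀ ∧ π.Chain' E

/-- A strategy for player 0 assigns to each position the (nonempty) block of vertices
appended by player 0's move; `(π ++ f π).Chain' E` says that this block is a path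
starting at the last vertex of `π`. -/
def IsStrategy (E : V → V → Prop) (v₀ : V) (f : List V → List V) : Prop :=
  ∀ π, IsPos E v₀ π → f π ≠ [] ∧ (π ++ f π).Chain' E

/-- The play `ρ` is consistent with the strategy `f`: there are cut points
`c 0, c 1, …` (the lengths of the prefixes built after each move of player 1) such that
after each such prefix player 0 plays according to `f`, and player 1 then appends a
nonempty block. -/
def ConsGen (f : List V → List V) (ρ : ℕ → V) : Prop :=
  ∃ c : ℕ → ℕ, 1 ≤ c 0 ∧ ∀ i,
    pref ρ (c i + (f (pref ρ (c i))).length) = pref ρ (c i) ++ f (pref ρ (c i)) ∧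
    c i + (f (pref ρ (c i))).length < c (i + 1)

/-- `f` is a winning strategy for player 0 in the Banach–Mazur game `(E, v₀, W)`. -/
def WinningStrategy (E : V → V → Prop) (v₀ : V) (W : Set (ℕ → V))
    (f : List V → List V) : Prop :=
  IsStrategy E v₀ f ∧ ∀ ρ, IsPlay E v₀ ρ → ConsGen f ρ → ρ ∈ W

/-- The strategy `f` is `b`-bounded: each of its moves has length at most `b`. -/
def BoundedBy (E : V → V → Prop) (v₀ : V) (b : ℕ) (f : List V → List V) : Prop :=
  ∀ π, IsPos E v₀ π → (f π).length ≤ b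

/-- A positional strategy assigns to each vertex the nonempty block appended. -/
def IsPositional (E : V → V → Prop) (f : V → List V) : Prop :=
  ∀ v, f v ≠ [] ∧ (v :: f v).Chain' E

/-- Consistency with a positional strategy: after each prefix chosen by player 1,
player 0 plays `f` of the current (last) vertex. -/
def ConsPositional (f : V → List V) (ρ : ℕ → V) : Prop :=
  ∃ c : ℕ → ℕ, 1 ≤ c 0 ∧ ∀ i,
    pref ρ (c i + (f (ρ (c i - 1))).length) = pref ρ (c i) ++ f (ρ (c i - 1)) ∧
    c i + (f (ρ (c i - 1))).length < c (i + 1)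

def PositionalWinning (E : V → V → Prop) (v₀ : V) (W : Set (ℕ → V)) (f : V → List V) : Prop :=
  IsPositional E f ∧ ∀ ρ, IsPlay E v₀ ρ → ConsPositional f ρ → ρ ∈ W

/-- Structural requirement shared by move-counting and length-counting strategies:
for `n ≥ 1`, `h v n` is a nonempty block forming a path from `v`. -/
def IsCountingStrategy (E : V → V → Prop) (h : V → ℕ → List V) : Prop :=
  ∀ v n, 1 ≤ n → h v n ≠ [] ∧ (v :: h v n).Chain' E

/-- Consistency with a move-counting strategy: at its `i`-th move (`i ≥ 1`) player 0 plays
`h (current vertex) i`. -/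
def ConsMoveCounting (h : V → ℕ → List V) (ρ : ℕ → V) : Prop :=
  ∃ c : ℕ → ℕ, 1 ≤ c 0 ∧ ∀ i,
    pref ρ (c i + (h (ρ (c i - 1)) (i + 1)).length) = pref ρ (c i) ++ h (ρ (c i - 1)) (i + 1) ∧
    c i + (h (ρ (c i - 1)) (i + 1)).length < c (i + 1)

def MoveCountingWinning (E : V → V → Prop) (v₀ : V) (W : Set (ℕ → V))
    (h : V → ℕ → List V) : Prop :=
  IsCountingStrategy E h ∧ ∀ ρ, IsPlay E v₀ ρ → ConsMoveCounting h ρ → ρ ∈ W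

/-- Consistency with a length-counting strategy: after a prefix of length `c i`
player 0 plays `h (current vertex) (c i)`. -/
def ConsLengthCounting (h : V → ℕ → List V) (ρ : ℕ → V) : Prop :=
  ∃ c : ℕ → ℕ, 1 ≤ c 0 ∧ ∀ i,
    pref ρ (c i + (h (ρ (c i - 1)) (c i)).length) = pref ρ (c i) ++ h (ρ (c i - 1)) (c i) ∧
    c i + (h (ρ (c i - 1)) (c i)).length < c (i + 1)

def LengthCountingWinning (E : V → V → Prop) (v₀ : V) (W : Set (ℕ → V))
    (h : V → ℕ → List V) : Prop :=
  IsCountingStrategy E h ∧ ∀ ρ, IsPlay E v₀ ρ → ConsLengthCounting h ρ → ρ ∈ W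

/-- The segment `ρ a, ρ (a+1), …, ρ (b-1)` of an infinite sequence. -/
def seg (ρ : ℕ → V) (a b : ℕ) : List V := (List.range (b - a)).map fun j => ρ (a + j)

/-- A last-move strategy is defined on all nonempty finite paths of the graph. -/
def IsLastMove (E : V → V → Prop) (g : List V → List V) : Prop :=
  ∀ π, π ≠ [] → π.Chain' E → g π ≠ [] ∧ (π ++ g π).Chain' E

/-- Consistency with the last-move strategy `g`: the play decomposes as
`π₁ g(π₁) π₂ g(π₂) ⋯` where the `πᵢ` are the (nonempty) moves of player 1. -/
def ConsLastMove (g : List V → List V) (ρ : ℕ → V) : Prop :=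
  ∃ s e : ℕ → ℕ, s 0 = 0 ∧ (∀ i, s i < e i) ∧ ∀ i,
    seg ρ (e i) (e i + (g (seg ρ (s i) (e i))).length) = g (seg ρ (s i) (e i)) ∧
    s (i + 1) = e i + (g (seg ρ (s i) (e i))).length

def LastMoveWinning (E : V → V → Prop) (v₀ : V) (W : Set (ℕ → V)) (g : List V → List V) : Prop :=
  IsLastMove E g ∧ ∀ ρ, IsPlay E v₀ ρ → ConsLastMove g ρ → ρ ∈ W

/-- The cylinder generated by the finite word `π`. -/
def Cyl (π : List V) : Set (ℕ → V) := {ρ | pref ρ π.length = π}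

/-- One-step transition probabilities obtained from the weights `w`. -/
noncomputable def transP [Fintype V] (E : V → V → Prop) (w : V → V → ℝ≥0) (u v : V) : ℝ≥0∞ := by
  classical
  exact if E u v then
    (w u v : ℝ≥0∞) / ∑ x ∈ Finset.univ.filter (fun x => E u x), (w u x : ℝ≥0∞)
  else 0

/-- The probability of the cylinder generated by a finite word: the product of the
one-step transition probabilities along it. -/
noncomputable def pathP [Fintype V] (E : V → V → Prop) (w : V → V → ℝ≥0) (π : List V) : ℝ≥0∞ :=
  ((π.zip π.tail).map fun q => transP E w q.1 q.2).prod

/-- `P` is the reasonable probability measure associated with the weights `w`. -/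
def IsReasonable [Fintype V] [MeasurableSpace (ℕ → V)] (E : V → V → Prop) (v₀ : V)
    (w : V → V → ℝ≥0) (P : Measure (ℕ → V)) : Prop :=
  IsProbabilityMeasure P ∧ ∀ π : List V, π.head? = some v₀ → P (Cyl π) = pathP E w π

/-- `Ps` is a legal move of player 0 in the generalised game `G_α` at position `π`: a
finite nonempty set of nonempty finite paths from the last vertex of `π` whose union of
cylinders has conditional probability at least `α` given `Cyl π`. -/
def LegalProposal [MeasurableSpace (ℕ → V)] (E : V → V → Prop) (P : Measure (ℕ → V)) (α : ℝ)
    (π : List V) (Ps : Finset (List V)) : Prop :=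
  Ps.Nonempty ∧ (∀ τ ∈ Ps, τ ≠ [] ∧ (π ++ τ).Chain' E) ∧
    ENNReal.ofReal α ≤ P (⋃ τ ∈ Ps, Cyl (π ++ τ)) / P (Cyl π)

/-- An α-strategy for player 0. -/
def IsAlphaStrategy [MeasurableSpace (ℕ → V)] (E : V → V → Prop) (v₀ : V) (P : Measure (ℕ → V))
    (α : ℝ) (f : List V → Finset (List V)) : Prop :=
  ∀ π, IsPos E v₀ π → LegalProposal E P α π (f π)

/-- Consistency with an α-strategy: at each stage, player 1 picks some element of the
set proposed by player 0 and appends a nonempty block after it. -/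
def ConsAlpha (f : List V → Finset (List V)) (ρ : ℕ → V) : Prop :=
  ∃ c : ℕ → ℕ, 1 ≤ c 0 ∧ ∀ i, ∃ τ ∈ f (pref ρ (c i)),
    pref ρ (c i + τ.length) = pref ρ (c i) ++ τ ∧ c i + τ.length < c (i + 1)

def AlphaWinning [MeasurableSpace (ℕ → V)] (E : V → V → Prop) (v₀ : V) (P : Measure (ℕ → V))
    (α : ℝ) (W : Set (ℕ → V)) (f : List V → Finset (List V)) : Prop :=
  IsAlphaStrategy E v₀ P α f ∧ ∀ ρ, IsPlay E v₀ ρ → ConsAlpha f ρ → ρ ∈ W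

/-- A strategy for player 1 in the generalised game `G_α` consists of an initial path and,
for each position together with a legal proposal of player 0, the selected element of the
proposal and the next (nonempty) block played by player 1. -/
def IsP1Strategy [MeasurableSpace (ℕ → V)] (E : V → V → Prop) (v₀ : V) (P : Measure (ℕ → V))
    (α : ℝ) (init : List V) (g : List V → Finset (List V) → List V × List V) : Prop :=
  IsPos E v₀ init ∧
    ∀ π Ps, IsPos E v₀ π → LegalProposal E P α π Ps →
      (g π Ps).1 ∈ Ps ∧ (g π Ps).2 ≠ [] ∧ (π ++ ((g π Ps).1 ++ (g π Ps).2)).Chain' E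

/-- Consistency of a play with player 1's strategy `(init, g)`:
there is a sequence of legal proposals of player 0 generating the play. -/
def ConsP1 [MeasurableSpace (ℕ → V)] (E : V → V → Prop) (P : Measure (ℕ → V)) (α : ℝ)
    (init : List V) (g : List V → Finset (List V) → List V × List V) (ρ : ℕ → V) : Prop :=
  ∃ (Ps : ℕ → Finset (List V)) (p : ℕ → List V), p 0 = init ∧
    (∀ n, pref ρ (p n).length = p n) ∧
    ∀ n, LegalProposal E P α (p n) (Ps n) ∧
      p (n + 1) = p n ++ ((g (p n) (Ps n)).1 ++ (g (p n) (Ps n)).2)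

def P1Winning [MeasurableSpace (ℕ → V)] (E : V → V → Prop) (v₀ : V) (P : Measure (ℕ → V))
    (α : ℝ) (W : Set (ℕ → V)) (init : List V)
    (g : List V → Finset (List V) → List V × List V) : Prop :=
  IsP1Strategy E v₀ P α init g ∧ ∀ ρ, IsPlay E v₀ ρ → ConsP1 E P α init g ρ → ρ ∉ W

/-- A union of cylinders, i.e. an open subset of the space of sequences. -/
def IsCylOpen (U : Set (ℕ → V)) : Prop :=
  ∃ S : Set (List V), U = ⋃ π ∈ S, Cyl π

/-- `W` is a countable intersection of open subsets of the space `Paths (G, v₀)`. -/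
def IsCountableInterOfOpens (E : V → V → Prop) (v₀ : V) (W : Set (ℕ → V)) : Prop :=
  ∃ U : ℕ → Set (ℕ → V), (∀ n, IsCylOpen (U n)) ∧
    W = {ρ | IsPlay E v₀ ρ} ∩ ⋂ n, U n

/-- For every `n`, the concatenation of the blocks `u 0, …, u (n-1)` is a prefix of `ρ`. -/
def AgreesWithBlocks (ρ : ℕ → V) (u : ℕ → List V) : Prop :=
  ∀ n, pref ρ (((List.range n).map u).flatten).length = ((List.range n).map u).flatten

end BMGame

open BMGame

namespace BMGame

section Cylinders

variable {V : Type*}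

@[simp]
lemma length_pref (ρ : ℕ → V) (n : ℕ) : (pref ρ n).length = n := by simp [pref]

lemma pref_prefix (ρ : ℕ → V) {m n : ℕ} (h : m ≤ n) : pref ρ m <+: pref ρ n := by
  rw [List.prefix_iff_eq_take, length_pref]
  simp [pref, ← List.map_take, List.take_range, h]

lemma mem_Cyl_pref (ρ : ℕ → V) (n : ℕ) : ρ ∈ Cyl (pref ρ n) := by simp [Cyl]

lemma prefix_pref_of_mem_Cyl {ρ : ℕ → V} {σ : List V} {m : ℕ} (h : ρ ∈ Cyl σ)
    (hm : σ.length ≤ m) : σ <+: pref ρ m := by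
  have := pref_prefix ρ hm
  rwa [show pref ρ σ.length = σ from h] at this

lemma Cyl_subset_of_prefix {σ π : List V} (h : σ <+: π) : Cyl π ⊆ Cyl σ := by
  intro ρ hρ
  have h₁ : pref ρ σ.length <+: π := by
    have := pref_prefix ρ h.length_le
    rwa [show pref ρ π.length = π from hρ] at this
  exact (List.prefix_of_prefix_length_le h₁ h (by simp)).eq_of_length (by simp)

lemma disjoint_Cyl {π σ : List V} (hl : π.length = σ.length) (h : π ≠ σ) :
    Disjoint (Cyl π) (Cyl σ) := by
  refine Set.disjoint_left.2 fun ρ h₁ h₂ => h ?_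
  rw [← show pref ρ π.length = π from h₁, ← show pref ρ σ.length = σ from h₂, hl]

lemma measurableSet_Cyl [MeasurableSpace V] [DiscreteMeasurableSpace V] (π : List V) :
    MeasurableSet (Cyl π) := by
  have : Cyl π = ⋂ i : Fin π.length, (fun ρ : ℕ → V => ρ i) ⁻¹' {π[i]} := by
    ext ρ
    simp only [Cyl, Set.mem_ofPred_eq, Set.mem_iInter, Set.mem_preimage, Set.mem_singleton_iff]
    constructor
    · intro h i
      have := List.getElem_of_eq h.symm i.2
      simpa [pref] using this.symm
    · intro h
      refine List.ext_getElem (by simp) fun i _ h₂ => ?_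
      simpa [pref] using h ⟨i, h₂⟩
  rw [this]
  exact MeasurableSet.iInter fun i => measurable_pi_apply _ (MeasurableSet.of_discrete)

/-- The union of all cylinders of words of length `m` that are contained in `U`. -/
def cylInterior (U : Set (ℕ → V)) (m : ℕ) : Set (ℕ → V) := {ρ | Cyl (pref ρ m) ⊆ U}

lemma cylInterior_mono (U : Set (ℕ → V)) : Monotone (cylInterior U) :=
  fun _ _ h ρ hρ => (Cyl_subset_of_prefix (pref_prefix ρ h)).trans hρ

lemma IsCylOpen.exists_Cyl_pref_subset {U : Set (ℕ → V)} (hU : IsCylOpen U) {ρ : ℕ → V}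
    (hρ : ρ ∈ U) : ∃ m, Cyl (pref ρ m) ⊆ U := by
  obtain ⟨S, rfl⟩ := hU
  simp only [Set.mem_iUnion] at hρ
  obtain ⟨π, hπ, h⟩ := hρ
  refine ⟨π.length, ?_⟩
  rw [show pref ρ π.length = π from h]
  exact Set.subset_biUnion_of_mem (u := Cyl) hπ

lemma isCylOpen_iff {U : Set (ℕ → V)} :
    IsCylOpen U ↔ ∀ ρ ∈ U, ∃ m, Cyl (pref ρ m) ⊆ U := by
  refine ⟨fun h ρ hρ => h.exists_Cyl_pref_subset hρ, fun h => ⟨{π | Cyl π ⊆ U}, ?_⟩⟩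
  refine subset_antisymm (fun ρ hρ => ?_) (Set.iUnion₂_subset fun _ => id)
  obtain ⟨m, hm⟩ := h ρ hρ
  exact Set.mem_biUnion (show pref ρ m ∈ {π | Cyl π ⊆ U} from hm) (mem_Cyl_pref ρ m)

lemma IsCylOpen.biInter_le {U : ℕ → Set (ℕ → V)} (hU : ∀ n, IsCylOpen (U n)) (n : ℕ) :
    IsCylOpen (⋂ k ≤ n, U k) := by
  rw [isCylOpen_iff]
  intro ρ hρ
  simp only [Set.mem_iInter] at hρ
  choose! m hm using fun k hk => (hU k).exists_Cyl_pref_subset (hρ k hk)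
  refine ⟨(Finset.range (n + 1)).sup m, Set.subset_iInter₂ fun k hk => ?_⟩
  have : m k ≤ (Finset.range (n + 1)).sup m := Finset.le_sup (by simpa [Nat.lt_succ_iff] using hk)
  exact cylInterior_mono (U k) this (hm k hk)

lemma IsCylOpen.iUnion_cylInterior {U : Set (ℕ → V)} (hU : IsCylOpen U) :
    ⋃ m, cylInterior U m = U := by
  ext ρ
  simp only [Set.mem_iUnion]
  exact ⟨fun ⟨m, hm⟩ => hm (mem_Cyl_pref ρ m), hU.exists_Cyl_pref_subset⟩

lemma IsCylOpen.measurableSet [Fintype V] [MeasurableSpace V] [DiscreteMeasurableSpace V]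
    {U : Set (ℕ → V)} (hU : IsCylOpen U) : MeasurableSet U := by
  obtain ⟨S, rfl⟩ := hU
  exact MeasurableSet.biUnion S.to_countable fun π _ => measurableSet_Cyl π

lemma measurableSet_cylInterior [Fintype V] [MeasurableSpace V] [DiscreteMeasurableSpace V]
    (U : Set (ℕ → V)) (m : ℕ) : MeasurableSet (cylInterior U m) := by
  refine IsCylOpen.measurableSet (isCylOpen_iff.2 fun ρ hρ => ⟨m, fun ρ' hρ' => ?_⟩)
  have h : pref ρ' m = pref ρ m := by simpa [Cyl] using hρ'
  rwa [cylInterior, Set.mem_ofPred_eq, h]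

end Cylinders

section Paths

variable {V : Type*} {E : V → V → Prop} {v₀ : V}

lemma IsPos.append {π τ : List V} (hπ : IsPos E v₀ π) (h : (π ++ τ).IsChain E) :
    IsPos E v₀ (π ++ τ) :=
  ⟨by simp [hπ.1], h⟩

lemma IsPos.ne_nil {π : List V} (hπ : IsPos E v₀ π) : π ≠ [] := by
  rintro rfl
  simpa using hπ.1

lemma IsPlay.isChain_pref {ρ : ℕ → V} (h : IsPlay E v₀ ρ) (n : ℕ) : (pref ρ n).IsChain E :=
  List.isChain_iff_getElem.2 fun i _ => by simpa [pref] using h.2 i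

lemma isPlay_of_frequently_isPos {ρ : ℕ → V} (h : ∀ n, ∃ m, n ≤ m ∧ IsPos E v₀ (pref ρ m)) :
    IsPlay E v₀ ρ := by
  constructor
  · obtain ⟨m, hm, hp⟩ := h 1
    obtain ⟨k, rfl⟩ := Nat.exists_eq_add_of_le' hm
    simpa [pref, List.range_succ_eq_map] using hp.1
  · intro n
    obtain ⟨m, hm, hp⟩ := h (n + 2)
    have := List.isChain_iff_getElem.1 (show (pref ρ m).IsChain E from hp.2) n
      (by simp; omega)
    simpa [pref] using this

/-- A strictly increasing sequence of finite words has a limit. -/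
lemma exists_pref_eq {p : ℕ → List V} (hp : ∀ n, p n <+: p (n + 1))
    (hl : ∀ n, (p n).length < (p (n + 1)).length) :
    ∃ ρ : ℕ → V, ∀ n, pref ρ (p n).length = p n := by
  have hmono : ∀ {m n}, m ≤ n → p m <+: p n := fun h => by
    induction h with
    | refl => exact List.prefix_rfl
    | step _ ih => exact ih.trans (hp _)
  have hlen : ∀ n, n ≤ (p n).length := fun _ => (strictMono_nat_of_lt_succ hl).le_apply
  refine ⟨fun k => (p (k + 1))[k]'(hlen (k + 1)), fun n => ?_⟩
  refine List.ext_getElem (by simp) fun i h₁ h₂ => ?_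
  simp only [pref, List.getElem_map, List.getElem_range]
  rcases le_total n (i + 1) with h | h
  · exact ((hmono h).getElem h₂).symm
  · exact (hmono h).getElem _

lemma exists_append_singleton_isChain (hE : ∀ v, ∃ u, E v u) {π : List V}
    (hπ : π ≠ []) (h : π.IsChain E) : ∃ u, (π ++ [u]).IsChain E := by
  obtain ⟨u, hu⟩ := hE (π.getLast hπ)
  refine ⟨u, List.isChain_append.2 ⟨h, by simp, ?_⟩⟩
  intro x hx y hy
  rw [List.getLast?_eq_getLast_of_ne_nil hπ] at hx
  simp_all

end Paths

section ReasonableMeasure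

variable {V : Type*} [Fintype V] {E : V → V → Prop} {v₀ : V} {w : V → V → ℝ≥0}

lemma transP_ne_zero_iff (hw : ∀ u v, E u v → 0 < w u v) {u v : V} :
    transP E w u v ≠ 0 ↔ E u v := by
  unfold transP
  split_ifs with h
  · simp only [h, iff_true]
    refine (ENNReal.div_pos ?_ ?_).ne'
    · exact_mod_cast (hw u v h).ne'
    · exact ENNReal.sum_ne_top.2 fun x _ => ENNReal.coe_ne_top
  · simp [h]

lemma pathP_ne_zero_iff (hw : ∀ u v, E u v → 0 < w u v) (π : List V) :
    pathP E w π ≠ 0 ↔ π.IsChain E := by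
  induction π with
  | nil => simp [pathP]
  | cons a l ih =>
    cases l with
    | nil => simp [pathP]
    | cons b l =>
      have : pathP E w (a :: b :: l) = transP E w a b * pathP E w (b :: l) := by simp [pathP]
      rw [this, mul_ne_zero_iff, ih, transP_ne_zero_iff hw, List.isChain_cons_cons]

variable [MeasurableSpace V] {P : Measure (ℕ → V)}

lemma IsReasonable.measure_Cyl_ne_zero_iff (hP : IsReasonable E v₀ w P)
    (hw : ∀ u v, E u v → 0 < w u v) {π : List V} (hπ : π.head? = some v₀) :
    P (Cyl π) ≠ 0 ↔ IsPos E v₀ π := by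
  rw [hP.2 π hπ, pathP_ne_zero_iff hw]
  exact ⟨fun h => ⟨hπ, h⟩, fun h => h.2⟩

lemma IsReasonable.measure_Cyl_root (hP : IsReasonable E v₀ w P) : P (Cyl [v₀]) = 1 := by
  rw [hP.2 _ rfl]
  simp [pathP]

lemma IsReasonable.measure_Cyl_root_compl [DiscreteMeasurableSpace V]
    (hP : IsReasonable E v₀ w P) : P (Cyl [v₀])ᶜ = 0 := by
  have := hP.1
  exact (prob_compl_eq_zero_iff (measurableSet_Cyl _)).2 hP.measure_Cyl_root

lemma IsReasonable.measure_isPlay_compl [DiscreteMeasurableSpace V]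
    (hP : IsReasonable E v₀ w P) (hw : ∀ u v, E u v → 0 < w u v) :
    P {ρ | IsPlay E v₀ ρ}ᶜ = 0 := by
  have hN : P (⋃ π ∈ {π : List V | π.head? = some v₀ ∧ ¬ IsPos E v₀ π}, Cyl π) = 0 := by
    refine (measure_biUnion_null_iff (Set.to_countable _)).2 fun π hπ => ?_
    exact not_not.1 fun h => hπ.2 ((hP.measure_Cyl_ne_zero_iff hw hπ.1).1 h)
  refine measure_mono_null (fun ρ hρ => ?_) (measure_union_null hP.measure_Cyl_root_compl hN)
  by_contra hcon
  simp only [Set.mem_union, Set.mem_compl_iff, not_or, not_not, Set.mem_iUnion, not_exists] at hcon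
  refine hρ (isPlay_of_frequently_isPos fun n => ⟨n + 1, n.le_succ, ?_⟩)
  by_contra hn
  have h0 : ρ 0 = v₀ := by simpa [Cyl, pref] using hcon.1
  exact hcon.2 (pref ρ (n + 1)) ⟨by simp [pref, List.range_succ_eq_map, h0], hn⟩
    (mem_Cyl_pref ρ _)

end ReasonableMeasure

section Game

variable {V : Type*} [MeasurableSpace V] {E : V → V → Prop} {v₀ : V}
  {P : Measure (ℕ → V)} {α : ℝ}

/-- The two players cannot both have a winning strategy. -/
lemma not_alphaWinning_and_P1Winning {W : Set (ℕ → V)} {f : List V → Finset (List V)}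
    {init : List V} {g : List V → Finset (List V) → List V × List V}
    (hf : AlphaWinning E v₀ P α W f) (hg : P1Winning E v₀ P α W init g) : False := by
  let p : ℕ → List V := fun n =>
    Nat.rec init (fun _ π => π ++ ((g π (f π)).1 ++ (g π (f π)).2)) n
  have hstep : ∀ n, p (n + 1) = p n ++ ((g (p n) (f (p n))).1 ++ (g (p n) (f (p n))).2) :=
    fun _ => rfl
  have hpos : ∀ n, IsPos E v₀ (p n) := fun n => by
    induction n with
    | zero => exact hg.1.1
    | succ n ih =>
      rw [hstep]
      exact ih.append (hg.1.2 _ _ ih (hf.1 _ ih)).2.2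
  have hmove := fun n => hg.1.2 _ _ (hpos n) (hf.1 _ (hpos n))
  have hlen : ∀ n, (p n).length + (g (p n) (f (p n))).1.length < (p (n + 1)).length := fun n => by
    have := List.length_pos_of_ne_nil (hmove n).2.1
    rw [hstep]
    simp only [List.length_append]
    omega
  have hlt : ∀ n, (p n).length < (p (n + 1)).length :=
    fun n => (Nat.le_add_right _ _).trans_lt (hlen n)
  obtain ⟨ρ, hρ⟩ := exists_pref_eq (fun n => hstep n ▸ List.prefix_append _ _) hlt
  have hplay : IsPlay E v₀ ρ := isPlay_of_frequently_isPos fun n =>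
    ⟨(p n).length, (strictMono_nat_of_lt_succ hlt).le_apply, by rw [hρ]; exact hpos n⟩
  refine hg.2 ρ hplay ⟨fun n => f (p n), p, rfl, hρ, fun n => ⟨hf.1 _ (hpos n), hstep n⟩⟩
    (hf.2 ρ hplay ⟨fun n => (p n).length, List.length_pos_of_ne_nil (hpos 0).ne_nil, fun n => ?_⟩)
  rw [hρ]
  refine ⟨_, (hmove n).1, ?_, hlen n⟩
  have hpre : p n ++ (g (p n) (f (p n))).1 <+: p (n + 1) := by
    rw [hstep, ← List.append_assoc]
    exact List.prefix_append _ _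
  have := Cyl_subset_of_prefix hpre (hρ (n + 1))
  simpa [Cyl] using this

/-- If the complement of `U` has conditional probability greater than `1 - α`, every legal
proposal contains an element after which this complement still has positive probability. -/
lemma LegalProposal.exists_measure_diff_ne_zero [DiscreteMeasurableSpace V] [IsFiniteMeasure P]
    {U : Set (ℕ → V)} {π : List V} {Ps : Finset (List V)}
    (hPs : LegalProposal E P α π Ps)
    (hπ : (1 - ENNReal.ofReal α) * P (Cyl π) < P (Cyl π \ U)) :
    ∃ τ ∈ Ps, P (Cyl (π ++ τ) \ U) ≠ 0 := by
  by_contra! hcon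
  have hπ0 : P (Cyl π) ≠ 0 := fun h =>
    absurd (measure_mono_null Set.sdiff_subset h) (zero_le.trans_lt hπ).ne'
  have hle : ENNReal.ofReal α * P (Cyl π) ≤ P (⋃ τ ∈ Ps, Cyl (π ++ τ)) :=
    (ENNReal.le_div_iff_mul_le (Or.inl hπ0) (Or.inl (measure_ne_top _ _))).1 hPs.2.2
  have hsub : ⋃ τ ∈ Ps, Cyl (π ++ τ) ⊆ Cyl π :=
    Set.iUnion₂_subset fun τ _ => Cyl_subset_of_prefix (List.prefix_append π τ)
  have hmeas : MeasurableSet (⋃ τ ∈ Ps, Cyl (π ++ τ)) :=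
    Ps.measurableSet_biUnion fun τ _ => measurableSet_Cyl _
  have hnull : P (⋃ τ ∈ Ps, Cyl (π ++ τ) \ U) = 0 :=
    (measure_biUnion_null_iff Ps.countable_toSet).2 hcon
  refine absurd hπ (not_lt.2 ?_)
  calc P (Cyl π \ U)
      ≤ P ((Cyl π \ ⋃ τ ∈ Ps, Cyl (π ++ τ)) ∪ ⋃ τ ∈ Ps, Cyl (π ++ τ) \ U) := by
        refine measure_mono fun ρ hρ => ?_
        by_cases h : ρ ∈ ⋃ τ ∈ Ps, Cyl (π ++ τ)
        · right
          simp only [Set.mem_iUnion] at h ⊢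
          obtain ⟨τ, hτ, h⟩ := h
          exact ⟨τ, hτ, h, hρ.2⟩
        · exact Or.inl ⟨hρ.1, h⟩
    _ ≤ P (Cyl π \ ⋃ τ ∈ Ps, Cyl (π ++ τ)) :=
        (measure_union_le _ _).trans_eq <| by
          rw [hnull, add_zero]
    _ = P (Cyl π) - P (⋃ τ ∈ Ps, Cyl (π ++ τ)) :=
        measure_sdiff hsub hmeas.nullMeasurableSet (measure_ne_top _ _)
    _ ≤ P (Cyl π) - ENNReal.ofReal α * P (Cyl π) := tsub_le_tsub_left hle _
    _ = (1 - ENNReal.ofReal α) * P (Cyl π) := by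
        rw [ENNReal.sub_mul fun _ _ => measure_ne_top _ _, one_mul]

variable [Fintype V]

/-- If `U` is open and conull, Player 0 has a legal proposal all of whose elements lead into `U`. -/
lemma exists_legalProposal_subset [IsFiniteMeasure P] (hα0 : 0 < α) (hα1 : α < 1)
    (hplay : P {ρ | IsPlay E v₀ ρ}ᶜ = 0)
    {U : Set (ℕ → V)} (hU : IsCylOpen U) (hPU : P Uᶜ = 0) {π : List V} (hπ : P (Cyl π) ≠ 0) :
    ∃ Ps : Finset (List V), LegalProposal E P α π Ps ∧ ∀ τ ∈ Ps, Cyl (π ++ τ) ⊆ U := by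
  classical
  have hsup : ⨆ m, P (Cyl π ∩ cylInterior U m) = P (Cyl π) := by
    rw [← Monotone.measure_iUnion
      fun m n h => Set.inter_subset_inter_right _ (cylInterior_mono U h),
      ← Set.inter_iUnion, hU.iUnion_cylInterior, measure_inter_conull hPU]
  have hlt : ENNReal.ofReal α * P (Cyl π) < ⨆ m, P (Cyl π ∩ cylInterior U m) := by
    rw [hsup]
    conv_rhs => rw [← one_mul (P (Cyl π))]
    exact ENNReal.mul_lt_mul_left hπ (measure_ne_top _ _) (by simpa using hα1)
  obtain ⟨m, hm⟩ := lt_iSup_iff.1 hlt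
  set n := max m (π.length + 1) with hn
  have hfin : {τ : List V | τ.length = n - π.length ∧ (π ++ τ).IsChain E ∧
      Cyl (π ++ τ) ⊆ U}.Finite := (List.finite_length_eq V (n - π.length)).subset fun τ h => h.1
  have hle : ENNReal.ofReal α * P (Cyl π) ≤ P (⋃ τ ∈ hfin.toFinset, Cyl (π ++ τ)) := by
    refine hm.le.trans ?_
    rw [← measure_inter_conull hplay]
    refine measure_mono ?_
    rintro ρ ⟨⟨hρ, hρm⟩, hρE⟩
    have hρn : Cyl (pref ρ n) ⊆ U := cylInterior_mono U (le_max_left _ _) hρm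
    obtain ⟨τ, hτ⟩ := prefix_pref_of_mem_Cyl hρ (show π.length ≤ n by omega)
    have hlen := congrArg List.length hτ
    simp only [List.length_append, length_pref] at hlen
    refine Set.mem_biUnion (x := τ) ?_ (hτ ▸ mem_Cyl_pref ρ n)
    simp only [Set.Finite.coe_toFinset, Set.mem_ofPred_eq, hτ]
    exact ⟨by omega, IsPlay.isChain_pref hρE n, hρn⟩
  have hpos : 0 < ENNReal.ofReal α * P (Cyl π) :=
    ENNReal.mul_pos (by simpa using hα0) hπ
  refine ⟨hfin.toFinset, ⟨?_, ?_, ?_⟩, ?_⟩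
  · by_contra hne
    rw [Finset.not_nonempty_iff_eq_empty.1 hne] at hle
    simp only [Finset.notMem_empty, Set.iUnion_of_empty, Set.iUnion_empty, measure_empty] at hle
    exact absurd hpos (not_lt.2 hle)
  · intro τ hτ
    obtain ⟨h₁, h₂, -⟩ := hfin.mem_toFinset.1 hτ
    refine ⟨?_, h₂⟩
    rintro rfl
    simp only [List.length_nil] at h₁
    omega
  · exact (ENNReal.le_div_iff_mul_le (Or.inl hπ) (Or.inl (measure_ne_top _ _))).2 hle
  · exact fun τ hτ => (hfin.mem_toFinset.1 hτ).2.2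

/-- Lebesgue density for complements of open sets, along extensions of a given word. -/
lemma exists_prefix_density [DiscreteMeasurableSpace V] [IsFiniteMeasure P]
    {U : Set (ℕ → V)} (hU : IsCylOpen U) {β : ℝ≥0∞} (hβ : β < 1) {σ : List V}
    (hσ : P (Cyl σ \ U) ≠ 0) :
    ∃ π, σ <+: π ∧ σ.length < π.length ∧ β * P (Cyl π) < P (Cyl π \ U) := by
  classical
  have hanti : Antitone fun m => Cyl σ \ cylInterior U m :=
    fun m n h => Set.sdiff_subset_sdiff_right (cylInterior_mono U h)
  have hinf : ⨅ m, P (Cyl σ \ cylInterior U m) = P (Cyl σ \ U) := by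
    rw [← hanti.measure_iInter
      (fun m => ((measurableSet_Cyl σ).diff (measurableSet_cylInterior U m)).nullMeasurableSet)
      ⟨0, measure_ne_top _ _⟩, ← Set.sdiff_iUnion, hU.iUnion_cylInterior]
  have hlt : P (Cyl σ \ U) < P (Cyl σ \ U) / β := by
    refine (ENNReal.lt_div_iff_mul_lt (Or.inr (measure_ne_top _ _))
      (Or.inl (hβ.trans ENNReal.one_lt_top).ne)).2 ?_
    conv_rhs => rw [← mul_one (P (Cyl σ \ U))]
    exact ENNReal.mul_lt_mul_right hσ (measure_ne_top _ _) hβ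
  obtain ⟨m, hm⟩ := iInf_lt_iff.1 (hinf.trans_lt hlt)
  have hm' : β * P (Cyl σ \ cylInterior U m) < P (Cyl σ \ U) := by
    rw [mul_comm]
    exact (ENNReal.lt_div_iff_mul_lt (Or.inr (measure_ne_top _ _))
      (Or.inl (hβ.trans ENNReal.one_lt_top).ne)).1 hm
  set n := max m (σ.length + 1) with hn
  by_contra! hcon
  have hfin : {π : List V | π.length = n ∧ σ <+: π ∧ ¬ Cyl π ⊆ U}.Finite :=
    (List.finite_length_eq V n).subset fun τ h => h.1
  refine absurd hm' (not_lt.2 ?_)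
  calc P (Cyl σ \ U) ≤ P (⋃ π ∈ hfin.toFinset, Cyl π \ U) := by
        refine measure_mono fun ρ hρ => ?_
        refine Set.mem_biUnion (x := pref ρ n) ?_ ⟨mem_Cyl_pref ρ n, hρ.2⟩
        simp only [Set.Finite.coe_toFinset, Set.mem_ofPred_eq, length_pref, true_and]
        exact ⟨prefix_pref_of_mem_Cyl hρ.1 (by omega), fun h => hρ.2 (h (mem_Cyl_pref ρ n))⟩
    _ ≤ ∑ π ∈ hfin.toFinset, P (Cyl π \ U) := measure_biUnion_finset_le _ _
    _ ≤ ∑ π ∈ hfin.toFinset, β * P (Cyl π) := by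
        refine Finset.sum_le_sum fun π hπ => ?_
        obtain ⟨h₁, h₂, -⟩ := hfin.mem_toFinset.1 hπ
        exact hcon π h₂ (by omega)
    _ = β * P (⋃ π ∈ hfin.toFinset, Cyl π) := by
        rw [← Finset.mul_sum, measure_biUnion_finset _ fun π _ => measurableSet_Cyl π]
        intro π hπ τ hτ hne
        exact disjoint_Cyl ((hfin.mem_toFinset.1 hπ).1.trans (hfin.mem_toFinset.1 hτ).1.symm) hne
    _ ≤ β * P (Cyl σ \ cylInterior U m) := by
        gcongr
        refine Set.iUnion₂_subset fun π hπ ρ hρ => ?_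
        obtain ⟨h₁, h₂, h₃⟩ := hfin.mem_toFinset.1 hπ
        have hρn : pref ρ n = π := by
          rw [← h₁]
          exact hρ
        refine ⟨Cyl_subset_of_prefix h₂ hρ, fun hρm => h₃ ?_⟩
        rw [← hρn]
        exact cylInterior_mono U (le_max_left _ _) hρm

variable [DiscreteMeasurableSpace V] {w : V → V → ℝ≥0}

lemma exists_alphaWinning (hP : IsReasonable E v₀ w P) (hw : ∀ u v, E u v → 0 < w u v)
    (hα0 : 0 < α) (hα1 : α < 1) {W : Set (ℕ → V)} (hW : IsCountableInterOfOpens E v₀ W)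
    (hPW : P Wᶜ = 0) : ∃ f, AlphaWinning E v₀ P α W f := by
  have := hP.1
  obtain ⟨U, hU, rfl⟩ := hW
  have hPU : ∀ n, P (⋂ k ≤ n, U k)ᶜ = 0 := fun n =>
    measure_mono_null (Set.compl_subset_compl.2 fun ρ hρ =>
      Set.mem_iInter₂.2 fun k _ => Set.mem_iInter.1 hρ.2 k) hPW
  choose! f hf using fun π (hπ : IsPos E v₀ π) =>
    exists_legalProposal_subset hα0 hα1 (hP.measure_isPlay_compl hw)
      (IsCylOpen.biInter_le hU π.length) (hPU _) ((hP.measure_Cyl_ne_zero_iff hw hπ.1).2 hπ)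
  refine ⟨f, fun π hπ => (hf π hπ).1, fun ρ hρ ⟨c, hc0, hc⟩ => ⟨hρ, Set.mem_iInter.2 fun n => ?_⟩⟩
  have hmono : StrictMono c := strictMono_nat_of_lt_succ fun i => by
    obtain ⟨τ, -, -, h⟩ := hc i
    omega
  obtain ⟨τ, hτ, hpre, -⟩ := hc n
  have hcn : 1 ≤ c n := hc0.trans (hmono.monotone n.zero_le)
  have hpos : IsPos E v₀ (pref ρ (c n)) := by
    obtain ⟨k, hk⟩ := Nat.exists_eq_add_of_le' hcn
    exact ⟨by simp [hk, pref, List.range_succ_eq_map, hρ.1], hρ.isChain_pref _⟩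
  have hmem : ρ ∈ ⋂ k ≤ (pref ρ (c n)).length, U k :=
    (hf _ hpos).2 τ hτ (hpre ▸ mem_Cyl_pref ρ _)
  exact Set.mem_iInter₂.1 hmem n (by simpa using hmono.le_apply)

lemma exists_P1Winning (hE : ∀ v, ∃ u, E v u) (hP : IsReasonable E v₀ w P)
    (hw : ∀ u v, E u v → 0 < w u v) (hα0 : 0 < α) {W U : Set (ℕ → V)} (hU : IsCylOpen U)
    (hWU : W ⊆ U) (hPU : P Uᶜ ≠ 0) : ∃ init g, P1Winning E v₀ P α W init g := by
  have := hP.1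
  have hβ : 1 - ENNReal.ofReal α < 1 :=
    ENNReal.sub_lt_self ENNReal.one_ne_top one_ne_zero (by simpa using hα0)
  -- From a word with non-null remainder outside `U`, extend to a position of high density.
  have hext : ∀ σ : List V, σ.head? = some v₀ → P (Cyl σ \ U) ≠ 0 → ∃ ξ, ξ ≠ [] ∧
      IsPos E v₀ (σ ++ ξ) ∧
        (1 - ENNReal.ofReal α) * P (Cyl (σ ++ ξ)) < P (Cyl (σ ++ ξ) \ U) := by
    intro σ hσ hσU
    obtain ⟨π, ⟨ξ, rfl⟩, hlen, hd⟩ := exists_prefix_density hU hβ hσU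
    refine ⟨ξ, by rintro rfl; simp at hlen, ?_, hd⟩
    refine (hP.measure_Cyl_ne_zero_iff hw (by simp [hσ])).1 fun h => ?_
    exact absurd (measure_mono_null Set.sdiff_subset h) (zero_le.trans_lt hd).ne'
  obtain ⟨ξ₀, -, hinit, hd₀⟩ := hext [v₀] rfl (by
    rwa [Set.sdiff_eq, Set.inter_comm, measure_inter_conull hP.measure_Cyl_root_compl])
  have hmove : ∀ π Ps, ∃ m : List V × List V, IsPos E v₀ π → LegalProposal E P α π Ps →
      (m.1 ∈ Ps ∧ m.2 ≠ [] ∧ (π ++ (m.1 ++ m.2)).IsChain E) ∧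
      ((1 - ENNReal.ofReal α) * P (Cyl π) < P (Cyl π \ U) →
        (1 - ENNReal.ofReal α) * P (Cyl (π ++ (m.1 ++ m.2))) < P (Cyl (π ++ (m.1 ++ m.2)) \ U)) := by
    intro π Ps
    by_cases h : IsPos E v₀ π ∧ LegalProposal E P α π Ps
    swap
    · exact ⟨([], []), fun h₁ h₂ => absurd ⟨h₁, h₂⟩ h⟩
    obtain ⟨hπ, hPs⟩ := h
    by_cases hd : (1 - ENNReal.ofReal α) * P (Cyl π) < P (Cyl π \ U)
    · obtain ⟨τ, hτ, hτU⟩ := hPs.exists_measure_diff_ne_zero hd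
      obtain ⟨ξ, hξ, hpos, hd'⟩ := hext (π ++ τ) (by simp [hπ.1]) hτU
      rw [List.append_assoc] at hpos hd'
      exact ⟨(τ, ξ), fun _ _ => ⟨⟨hτ, hξ, hpos.2⟩, fun _ => hd'⟩⟩
    · obtain ⟨τ, hτ⟩ := hPs.1
      obtain ⟨u, hu⟩ := exists_append_singleton_isChain hE
        (by simp [hπ.ne_nil]) (hPs.2.1 τ hτ).2
      rw [List.append_assoc] at hu
      exact ⟨(τ, [u]), fun _ _ => ⟨⟨hτ, by simp, hu⟩, fun h => absurd h hd⟩⟩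
  choose g hg using hmove
  refine ⟨_, g, ⟨hinit, fun π Ps hπ hPs => (hg π Ps hπ hPs).1⟩, ?_⟩
  rintro ρ - ⟨Ps, p, hp0, hpρ, hp⟩ hρW
  have hinv : ∀ n, IsPos E v₀ (p n) ∧
      (1 - ENNReal.ofReal α) * P (Cyl (p n)) < P (Cyl (p n) \ U) := fun n => by
    induction n with
    | zero => exact hp0 ▸ ⟨hinit, hd₀⟩
    | succ n ih =>
      obtain ⟨hleg, hstep⟩ := hp n
      have h := hg _ _ ih.1 hleg
      rw [hstep]
      exact ⟨ih.1.append h.1.2.2, h.2 ih.2⟩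
  have hmono : StrictMono fun n => (p n).length := strictMono_nat_of_lt_succ fun n => by
    have := List.length_pos_of_ne_nil (hg _ _ (hinv n).1 (hp n).1).1.2.1
    rw [(hp n).2]
    simp only [List.length_append]
    omega
  obtain ⟨m, hm⟩ := hU.exists_Cyl_pref_subset (hWU hρW)
  have hsub : Cyl (p m) ⊆ U := by
    rw [← hpρ m]
    exact cylInterior_mono U hmono.le_apply hm
  have h := (hinv m).2
  rw [Set.sdiff_eq_empty.2 hsub, measure_empty] at h
  exact not_lt_zero h

end Game

end BMGame

/-- For `0 < α < 1` and `W` a countable intersection of open subsets of `Paths (G, v₀)`,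
the generalised Banach–Mazur game `G_α` is determined: Player 0 has a winning α-strategy
iff `P (W) = 1`, and Player 1 has a winning strategy iff `P (W) < 1`. -/
theorem stmt15 {V : Type*} [Fintype V] [MeasurableSpace V] [DiscreteMeasurableSpace V]
    (E : V → V → Prop) (hE : ∀ v, ∃ u, E v u) (v₀ : V)
    (α : ℝ) (hα0 : 0 < α) (hα1 : α < 1)
    (W : Set (ℕ → V)) (hGδ : IsCountableInterOfOpens E v₀ W)
    (w : V → V → ℝ≥0) (hw : ∀ u v, E u v → 0 < w u v)
    (P : MeasureTheory.Measure (ℕ → V)) (hP : IsReasonable E v₀ w P) :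
    ((∃ f : List V → Finset (List V), AlphaWinning E v₀ P α W f) ↔ P Wᶜ = 0) ∧
    ((∃ (init : List V) (g : List V → Finset (List V) → List V × List V),
        P1Winning E v₀ P α W init g) ↔ P W < 1) := by
  have hprob := hP.1
  have hplay := hP.measure_isPlay_compl hw
  have hzero : P Wᶜ = 0 → ∃ f, AlphaWinning E v₀ P α W f :=
    exists_alphaWinning hP hw hα0 hα1 hGδ
  have hdet : P Wᶜ = 0 ∨ P W < 1 ∧ ∃ init g, P1Winning E v₀ P α W init g := by
    obtain ⟨U, hU, rfl⟩ := hGδ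
    by_cases h : ∀ n, P (U n)ᶜ = 0
    · left
      rw [Set.compl_inter, Set.compl_iInter]
      exact measure_union_null hplay (measure_iUnion_null h)
    · right
      push Not at h
      obtain ⟨n, hn⟩ := h
      have hsub : {ρ | IsPlay E v₀ ρ} ∩ ⋂ n, U n ⊆ U n :=
        Set.inter_subset_right.trans (Set.iInter_subset U n)
      refine ⟨(measure_mono hsub).trans_lt (lt_of_le_of_ne prob_le_one fun h => hn ?_),
        exists_P1Winning hE hP hw hα0 (hU n) hsub hn⟩
      exact (prob_compl_eq_zero_iff (hU n).measurableSet).2 h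
  have hone : P Wᶜ = 0 → P W = 1 := fun h => by
    rw [← Set.univ_inter W, measure_inter_conull h, measure_univ]
  constructor
  · refine ⟨fun ⟨f, hf⟩ => ?_, hzero⟩
    rcases hdet with h | ⟨-, init, g, hg⟩
    · exact h
    · exact (not_alphaWinning_and_P1Winning hf hg).elim
  · constructor
    · rintro ⟨init, g, hg⟩
      rcases hdet with h | h
      · obtain ⟨f, hf⟩ := hzero h
        exact (not_alphaWinning_and_P1Winning hf hg).elim
      · exact h.1
    · intro h
      rcases hdet with h' | h'
      · exact absurd (hone h') h.ne
      · exact h'.2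
end

section
/- Let (ρ_n)_{n≥1} be any enumeration of all nonempty finite words over {0,1}, let ρ_target = 0ρ₁ρ₂⋯ be the concatenation, and let W = {σ ∈ {0,1}^ω : σ(i) = ρ_target(i) for infinitely many i ≥ 1}. In the Banach–Mazur game (G_{0,1}, 0, W), Player 0 has a bounded length-counting winning strategy, but Player 0 has no positional winning strategy. -/
open MeasureTheory
open scoped ENNReal NNReal

open BMGame

/-- The complete directed graph on `{0,1}` (all edges, including self-loops). -/
def E2 : Fin 2 → Fin 2 → Prop := fun _ _ => True

/-- A prefix is extended by the block `l` exactly when `l` occurs at position `n`. -/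
theorem pref_append_iff {V : Type*} (ρ : ℕ → V) (n : ℕ) (l : List V) :
    pref ρ (n + l.length) = pref ρ n ++ l ↔ ∀ j (hj : j < l.length), ρ (n + j) = l[j] := by
  have hsplit : pref ρ (n + l.length) =
      pref ρ n ++ (List.range l.length).map fun j => ρ (n + j) := by
    simp [pref, List.range_add, Function.comp_def]
  rw [hsplit, List.append_cancel_left_eq]
  constructor
  · intro h j hj
    simp [← List.getElem_of_eq h (by simpa using hj)]
  · intro h
    exact List.ext_getElem (by simp) fun j h₁ h₂ => by simp [h j h₂]

/-- Every block of a concatenation occurs in it as a factor. -/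
theorem BMGame.AgreesWithBlocks.exists_occurrence {V : Type*} {ρ : ℕ → V} {u : ℕ → List V}
    (h : AgreesWithBlocks ρ u) (n : ℕ) :
    ∃ p, ∀ j (hj : j < (u n).length), ρ (p + j) = (u n)[j] := by
  refine ⟨(((List.range n).map u).flatten).length, (pref_append_iff ρ _ _).1 ?_⟩
  have hn := h (n + 1)
  simp only [List.range_succ, List.map_append, List.map_singleton, List.flatten_append,
    List.flatten_singleton, List.length_append] at hn
  rw [hn, h n]

/-- If every nonempty word occurs in `ρ`, then every word occurs arbitrarily far in `ρ`. -/
theorem exists_occurrence_ge {V : Type*} [Inhabited V] {ρ : ℕ → V}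
    (h : ∀ l : List V, l ≠ [] → ∃ p, ∀ j (hj : j < l.length), ρ (p + j) = l[j])
    (w : List V) (hw : w ≠ []) (N : ℕ) :
    ∃ p ≥ N, ∀ j (hj : j < w.length), ρ (p + j) = w[j] := by
  obtain ⟨p, hp⟩ := h (List.replicate N default ++ w) (by simp [hw])
  refine ⟨p + N, by omega, fun j hj => ?_⟩
  have := hp (N + j) (by simpa using hj)
  rw [List.getElem_append_right (by simp)] at this
  simpa [add_assoc] using this

/-- A sequence in which `v :: f v` occurs arbitrarily far is consistent with `f`. -/
theorem consPositional_of_occurrences {V : Type*} (f : V → List V) (ρ : ℕ → V) (v : V)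
    (h : ∀ N, ∃ p ≥ N, ρ p = v ∧ ∀ j (hj : j < (f v).length), ρ (p + 1 + j) = (f v)[j]) :
    ConsPositional f ρ := by
  choose P hP hv hf using h
  let next : ℕ → ℕ := fun m => P (m + (f v).length + 1) + 1
  let c : ℕ → ℕ := fun i => next^[i + 1] 0
  have hc : ∀ i, c i = next (next^[i] 0) := fun i => Function.iterate_succ_apply' next i 0
  have hlast : ∀ i, ρ (c i - 1) = v := fun i => by
    rw [hc]
    exact hv _
  refine ⟨c, by rw [hc]; exact Nat.le_add_left _ _, fun i => ?_⟩
  rw [hlast i]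
  refine ⟨(pref_append_iff ρ _ _).2 ?_, ?_⟩
  · rw [hc]
    exact hf _
  · have := hP (c i + (f v).length + 1)
    rw [hc (i + 1)]
    change c i + (f v).length < P (c i + (f v).length + 1) + 1
    omega

/-- For any enumeration `(e n)ₙ` of the nonempty finite words over `{0,1}` and
`ρt = 0 · e 0 · e 1 · ⋯`, in the game on `G_{0,1}` from `0` whose winning condition is the
set of sequences agreeing with `ρt` at infinitely many indices, Player 0 has a bounded
length-counting winning strategy but no positional winning strategy. -/
theorem stmt17 (e : ℕ → List (Fin 2)) (he_inj : Function.Injective e)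
    (he_ne : ∀ n, e n ≠ []) (he_surj : ∀ l : List (Fin 2), l ≠ [] → ∃ n, e n = l)
    (ρt : ℕ → Fin 2)
    (hρt : AgreesWithBlocks ρt fun i =>
      match i with
      | 0 => ([0] : List (Fin 2))
      | j + 1 => e j) :
    (∃ (h : Fin 2 → ℕ → List (Fin 2)) (b : ℕ), 1 ≤ b ∧
        LengthCountingWinning E2 0 {σ | {i | σ i = ρt i}.Infinite} h ∧
        ∀ v n, 1 ≤ n → (h v n).length ≤ b) ∧
    ¬ ∃ f : Fin 2 → List (Fin 2),
        PositionalWinning E2 0 {σ | {i | σ i = ρt i}.Infinite} f := by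
  refine ⟨⟨fun _ n => [ρt n], 1, le_rfl,
    ⟨fun v n _ => ⟨by simp, List.isChain_pair.2 trivial⟩, ?_⟩, by simp⟩, ?_⟩
  · rintro ρ - ⟨c, -, hc⟩
    have hmono : StrictMono c := strictMono_nat_of_lt_succ fun i => by
      have := (hc i).2
      simp only [List.length_singleton] at this
      omega
    refine (Set.infinite_range_of_injective hmono.injective).mono ?_
    rintro _ ⟨i, rfl⟩
    simpa using (pref_append_iff ρ _ _).1 (hc i).1 0 (by simp)
  · rintro ⟨f, -, hf⟩
    have hocc := exists_occurrence_ge (ρ := ρt) fun l hl => by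
      obtain ⟨n, rfl⟩ := he_surj l hl
      exact hρt.exists_occurrence (n + 1)
    let σ : ℕ → Fin 2 := fun k => if k = 0 then 0 else 1 - ρt k
    have hσ : ∀ k, k ≠ 0 → σ k = 1 - ρt k := fun k hk => if_neg hk
    have hne : ∀ x : Fin 2, 1 - x ≠ x := by decide
    refine hf σ ⟨rfl, fun _ => trivial⟩ (consPositional_of_occurrences f σ 0 fun N => ?_)
      ((Set.finite_singleton 0).subset fun k hk => ?_)
    · obtain ⟨p, hp, hw⟩ := hocc (1 :: (f 0).map (1 - ·)) (by simp) (N + 1)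
      refine ⟨p, by omega, ?_, fun j hj => ?_⟩
      · have := hw 0 (by simp)
        rw [hσ p (by omega)]
        simp_all
      · have := hw (j + 1) (by simpa using hj)
        rw [hσ _ (by omega), add_assoc, add_comm 1 j, this]
        simp
    · by_contra h0
      exact hne _ ((hσ k h0).symm.trans hk)
end
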